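/- arXiv:2211.03197 — 2 statements merged into one kernel-verified Lean document; each statement's English description precedes it below -/
import Mathlib

section
/- Let g be a C² function on an open set U ⊆ ℝ⁴ with coordinates (x₀,x₁,x₂,x₃), and for λ ∈ ℝ let α_λ be the 1-form with components A₀(λ) = 1 − λg₃ − λ²g₂ − λ³g₁, A₁(λ) = λ − λ²g₃ − λ³g₂, A₂(λ) = λ² − λ³g₃, A₃(λ) = λ³, and set B_{ij}(λ) = ∂_iA_j(λ) − ∂_jA_i(λ). Then the condition dα_λ ∧ dα_λ = 0 on U for every λ ∈ ℝ — explicitly B₀₁B₂₃ − B₀₂B₁₃ + B₀₃B₁₂ = 0 on U for every λ — holds if and only if g satisfies the heavenly equation −g₀₂g₃₃ + g₀₃g₂₃ + g₁₁g₃₃ − g₁₂g₂₃ − g₁₃² + g₁₃g₂₂ = 0 on U. -/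
/-- Partial derivative `∂f/∂x_j` on ℝ⁴. -/
noncomputable def pd (f : (Fin 4 → ℝ) → ℝ) (j : Fin 4) (x : Fin 4 → ℝ) : ℝ :=
  fderiv ℝ f x (Pi.single j 1)

/-- Second partial derivative `∂²f/∂x_i∂x_j` on ℝ⁴. -/
noncomputable def pd2 (f : (Fin 4 → ℝ) → ℝ) (i j : Fin 4) (x : Fin 4 → ℝ) : ℝ :=
  pd (pd f j) i x

/-- The components of the 1-form `α_λ`:
`A₀ = 1 − λg₃ − λ²g₂ − λ³g₁`, `A₁ = λ − λ²g₃ − λ³g₂`, `A₂ = λ² − λ³g₃`, `A₃ = λ³`. -/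
noncomputable def A (g : (Fin 4 → ℝ) → ℝ) (lam : ℝ) : Fin 4 → (Fin 4 → ℝ) → ℝ :=
  ![fun y => 1 - lam * pd g 3 y - lam ^ 2 * pd g 2 y - lam ^ 3 * pd g 1 y,
    fun y => lam - lam ^ 2 * pd g 3 y - lam ^ 3 * pd g 2 y,
    fun y => lam ^ 2 - lam ^ 3 * pd g 3 y,
    fun _ => lam ^ 3]

/-- `B_{ij}(λ) = ∂_i A_j(λ) − ∂_j A_i(λ)`, the components of `dα_λ`. -/
noncomputable def B (g : (Fin 4 → ℝ) → ℝ) (lam : ℝ) (i j : Fin 4) (x : Fin 4 → ℝ) : ℝ :=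
  pd (A g lam j) i x - pd (A g lam i) j x

theorem ContDiffAt.differentiableAt_pd {g : (Fin 4 → ℝ) → ℝ} {x : Fin 4 → ℝ}
    (hg : ContDiffAt ℝ 2 g x) (j : Fin 4) : DifferentiableAt ℝ (pd g j) x :=
  ((hg.fderiv_right (m := 1) (by norm_num)).differentiableAt (by norm_num)).clm_apply
    (differentiableAt_const _)

theorem ContDiffAt.pd2_eq_fderiv_fderiv {g : (Fin 4 → ℝ) → ℝ} {x : Fin 4 → ℝ}
    (hg : ContDiffAt ℝ 2 g x) (i j : Fin 4) :
    pd2 g i j x = fderiv ℝ (fderiv ℝ g) x (Pi.single i 1) (Pi.single j 1) := by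
  have hd : DifferentiableAt ℝ (fderiv ℝ g) x :=
    (hg.fderiv_right (m := 1) (by norm_num)).differentiableAt (by norm_num)
  have h := (hd.hasFDerivAt.clm_apply
    (hasFDerivAt_const (Pi.single j (1 : ℝ) : Fin 4 → ℝ) x)).fderiv
  change fderiv ℝ (fun y => fderiv ℝ g y (Pi.single j 1)) x (Pi.single i 1) = _
  rw [h]
  simp

theorem ContDiffAt.pd2_comm {g : (Fin 4 → ℝ) → ℝ} {x : Fin 4 → ℝ}
    (hg : ContDiffAt ℝ 2 g x) (i j : Fin 4) : pd2 g i j x = pd2 g j i x := by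
  rw [hg.pd2_eq_fderiv_fderiv, hg.pd2_eq_fderiv_fderiv]
  exact hg.isSymmSndFDerivAt (by simp) _ _

theorem pd_const_sub_cubic {g₁ g₂ g₃ : (Fin 4 → ℝ) → ℝ} {x : Fin 4 → ℝ}
    (h₁ : DifferentiableAt ℝ g₁ x) (h₂ : DifferentiableAt ℝ g₂ x)
    (h₃ : DifferentiableAt ℝ g₃ x) (c a₁ a₂ a₃ : ℝ) (i : Fin 4) :
    pd (fun y => c - a₁ * g₁ y - a₂ * g₂ y - a₃ * g₃ y) i x
      = -a₁ * pd g₁ i x - a₂ * pd g₂ i x - a₃ * pd g₃ i x := by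
  have h := ((((hasFDerivAt_const c x).sub (h₁.hasFDerivAt.const_mul a₁)).sub
    (h₂.hasFDerivAt.const_mul a₂)).sub (h₃.hasFDerivAt.const_mul a₃)).fderiv
  change fderiv ℝ (fun y => c - a₁ * g₁ y - a₂ * g₂ y - a₃ * g₃ y) x _ = _
  erw [h]
  simp [pd]

/-- The `λ`-dependence of `dα_λ ∧ dα_λ` is an overall factor `λ⁶`. -/
theorem ContDiffAt.dalpha_wedge_dalpha_eq {g : (Fin 4 → ℝ) → ℝ} {x : Fin 4 → ℝ}
    (hg : ContDiffAt ℝ 2 g x) (lam : ℝ) :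
    B g lam 0 1 x * B g lam 2 3 x - B g lam 0 2 x * B g lam 1 3 x
      + B g lam 0 3 x * B g lam 1 2 x =
    lam ^ 6 * (-(pd2 g 0 2 x) * pd2 g 3 3 x + pd2 g 0 3 x * pd2 g 2 3 x
      + pd2 g 1 1 x * pd2 g 3 3 x - pd2 g 1 2 x * pd2 g 2 3 x
      - (pd2 g 1 3 x) ^ 2 + pd2 g 1 3 x * pd2 g 2 2 x) := by
  have hd := hg.differentiableAt_pd
  have h₀ (i : Fin 4) : pd (A g lam 0) i x
      = -lam * pd2 g i 3 x - lam ^ 2 * pd2 g i 2 x - lam ^ 3 * pd2 g i 1 x :=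
    pd_const_sub_cubic (hd 3) (hd 2) (hd 1) 1 lam (lam ^ 2) (lam ^ 3) i
  have h₁ (i : Fin 4) : pd (A g lam 1) i x
      = -lam ^ 2 * pd2 g i 3 x - lam ^ 3 * pd2 g i 2 x := by
    simpa [A, pd2] using pd_const_sub_cubic (hd 3) (hd 2) (hd 1) lam (lam ^ 2) (lam ^ 3) 0 i
  have h₂ (i : Fin 4) : pd (A g lam 2) i x = -lam ^ 3 * pd2 g i 3 x := by
    simpa [A, pd2] using pd_const_sub_cubic (hd 3) (hd 2) (hd 1) (lam ^ 2) (lam ^ 3) 0 0 i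
  have h₃ (i : Fin 4) : pd (A g lam 3) i x = 0 := by
    simp [A, pd]
  simp only [B, h₀, h₁, h₂, h₃]
  rw [hg.pd2_comm 2 1, hg.pd2_comm 3 1, hg.pd2_comm 3 2]
  ring

/-- For a C² function `g` on an open `U ⊆ ℝ⁴`, the condition
`dα_λ ∧ dα_λ = 0` on `U` for every `λ ∈ ℝ` (explicitly
`B₀₁B₂₃ − B₀₂B₁₃ + B₀₃B₁₂ = 0`) holds if and only if `g` satisfies the heavenly
equation `−g₀₂g₃₃ + g₀₃g₂₃ + g₁₁g₃₃ − g₁₂g₂₃ − g₁₃² + g₁₃g₂₂ = 0` on `U`. -/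
theorem dalpha_wedge_dalpha_iff_heavenly
    (U : Set (Fin 4 → ℝ)) (hU : IsOpen U)
    (g : (Fin 4 → ℝ) → ℝ) (hg : ContDiffOn ℝ 2 g U) :
    (∀ lam : ℝ, ∀ x ∈ U,
      B g lam 0 1 x * B g lam 2 3 x - B g lam 0 2 x * B g lam 1 3 x
      + B g lam 0 3 x * B g lam 1 2 x = 0)
    ↔
    (∀ x ∈ U,
      -(pd2 g 0 2 x) * pd2 g 3 3 x + pd2 g 0 3 x * pd2 g 2 3 x
      + pd2 g 1 1 x * pd2 g 3 3 x - pd2 g 1 2 x * pd2 g 2 3 x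
      - (pd2 g 1 3 x) ^ 2 + pd2 g 1 3 x * pd2 g 2 2 x = 0) := by
  have hgx (x) (hx : x ∈ U) : ContDiffAt ℝ 2 g x := hg.contDiffAt (hU.mem_nhds hx)
  constructor
  · intro h x hx
    simpa [(hgx x hx).dalpha_wedge_dalpha_eq] using h 1 x hx
  · intro h lam x hx
    rw [(hgx x hx).dalpha_wedge_dalpha_eq, h x hx, mul_zero]
end

section
/- Let f be a C³ function on an open set U ⊆ ℝ⁴ such that x₁ ≠ x₃ and f₂₄ ≠ 0 everywhere on U, satisfying the heavenly equation (case G₀) (x₁−x₃)²(f₁₄f₂₃ − f₁₃f₂₄) + f₂f₄ = 0 on U. Then for every λ ∈ ℝ the vector fields X₁(λ) = (x₁−λ)∂₁ + (f₁₄/f₂₄)(λ−x₁)∂₂ + ((λ−x₃)f₂/((x₁−x₃)f₂₄))∂₄ and X₂(λ) = −((λ−x₁)f₄/((x₁−x₃)f₂₄))∂₂ + (x₃−λ)∂₃ + (f₂₃/f₂₄)(λ−x₃)∂₄ commute on U: [X₁(λ),X₂(λ)] = 0. -/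
open scoped BigOperators

/-- Lie bracket of vector fields on ℝ⁴:
`[X,Y]^i = ∑_j (X^j ∂_j Y^i − Y^j ∂_j X^i)`. -/
noncomputable def lieB (X Y : (Fin 4 → ℝ) → (Fin 4 → ℝ)) (x : Fin 4 → ℝ) : Fin 4 → ℝ :=
  fun i => ∑ j, (X x j * pd (fun y => Y y i) j x - Y x j * pd (fun y => X y i) j x)

section PartialDerivatives

variable {f g : (Fin 4 → ℝ) → ℝ} {U : Set (Fin 4 → ℝ)} {x : Fin 4 → ℝ}

lemma pd_congr (h : f =ᶠ[nhds x] g) (j : Fin 4) : pd f j x = pd g j x := by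
  simp only [pd, h.fderiv_eq]

lemma pd_const (c : ℝ) (j : Fin 4) : pd (fun _ => c) j x = 0 := by
  simp [pd]

lemma pd_coord (i j : Fin 4) : pd (fun y => y i) j x = if i = j then 1 else 0 := by
  simp [pd, (hasFDerivAt_apply (𝕜 := ℝ) i x).fderiv, Pi.single_apply]

lemma pd_add (hf : DifferentiableAt ℝ f x) (hg : DifferentiableAt ℝ g x) (j : Fin 4) :
    pd (fun y => f y + g y) j x = pd f j x + pd g j x := by
  simp [pd, fderiv_fun_add hf hg]

lemma pd_sub (hf : DifferentiableAt ℝ f x) (hg : DifferentiableAt ℝ g x) (j : Fin 4) :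
    pd (fun y => f y - g y) j x = pd f j x - pd g j x := by
  simp [pd, fderiv_fun_sub hf hg]

lemma pd_neg (j : Fin 4) : pd (fun y => -f y) j x = -pd f j x := by
  simp [pd, fderiv_fun_neg]

lemma pd_mul (hf : DifferentiableAt ℝ f x) (hg : DifferentiableAt ℝ g x) (j : Fin 4) :
    pd (fun y => f y * g y) j x = f x * pd g j x + g x * pd f j x := by
  simp [pd, fderiv_fun_mul hf hg]

lemma pd_div (hf : DifferentiableAt ℝ f x) (hg : DifferentiableAt ℝ g x) (hx : g x ≠ 0)
    (j : Fin 4) :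
    pd (fun y => f y / g y) j x = (pd f j x * g x - f x * pd g j x) / g x ^ 2 := by
  have h := (hf.hasFDerivAt.mul ((hasDerivAt_inv hx).comp_hasFDerivAt x hg.hasFDerivAt))
  have h' : HasFDerivAt (fun y => f y / g y) _ x := h
  simp only [pd, h'.fderiv]
  simp
  field_simp
  ring

lemma contDiffOn_pd {m n : WithTop ℕ∞} (hU : IsOpen U) (hf : ContDiffOn ℝ n f U)
    (hmn : m + 1 ≤ n) (j : Fin 4) : ContDiffOn ℝ m (pd f j) U :=
  (hf.fderiv_of_isOpen hU hmn).clm_apply contDiffOn_const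

lemma pd2_comm (hU : IsOpen U) (hf : ContDiffOn ℝ 2 f U) (hx : x ∈ U) (i j : Fin 4) :
    pd2 f i j x = pd2 f j i x := by
  have hd : DifferentiableAt ℝ (fderiv ℝ f) x :=
    ((hf.fderiv_of_isOpen (m := 1) hU (by norm_num)).contDiffAt (hU.mem_nhds hx)).differentiableAt
      one_ne_zero
  have key (k l : Fin 4) :
      pd2 f k l x = fderiv ℝ (fderiv ℝ f) x (Pi.single k 1) (Pi.single l 1) := by
    have h : HasFDerivAt (pd f l) _ x :=
      hd.hasFDerivAt.clm_apply (hasFDerivAt_const (Pi.single l 1 : Fin 4 → ℝ) x)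
    simp [pd2, pd.eq_1 (pd f l), h.fderiv]
  rw [key, key]
  exact ((hf.contDiffAt (hU.mem_nhds hx)).isSymmSndFDerivAt (by simp)) _ _

lemma pd_pd2_swap_outer (hU : IsOpen U) (hf : ContDiffOn ℝ 3 f U) (hx : x ∈ U)
    (i j k : Fin 4) : pd (pd2 f i j) k x = pd (pd2 f k j) i x :=
  pd2_comm hU (contDiffOn_pd hU hf (by norm_num) j) hx k i

lemma pd_pd2_swap_inner (hU : IsOpen U) (hf : ContDiffOn ℝ 3 f U) (hx : x ∈ U)
    (i j k : Fin 4) : pd (pd2 f i j) k x = pd (pd2 f j i) k x :=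
  pd_congr (Filter.eventually_of_mem (hU.mem_nhds hx) fun _ hy =>
    pd2_comm hU (hf.of_le (by norm_num)) hy i j) k

end PartialDerivatives

/-- If `f` is C³ on an open `U ⊆ ℝ⁴` with `x₁ ≠ x₃` and `f₂₄ ≠ 0`
everywhere on `U`, and satisfies the heavenly equation (case G₀)
`(x₁−x₃)²(f₁₄f₂₃ − f₁₃f₂₄) + f₂f₄ = 0`, then for every `λ` the Lax pair vector
fields `X₁(λ), X₂(λ)` commute on `U`. -/
theorem heavenly_G0_lax_pair_commutes
    (U : Set (Fin 4 → ℝ)) (hU : IsOpen U)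
    (f : (Fin 4 → ℝ) → ℝ) (hf : ContDiffOn ℝ 3 f U)
    (hx13 : ∀ x ∈ U, x 0 ≠ x 2)
    (hf24 : ∀ x ∈ U, pd2 f 1 3 x ≠ 0)
    (heq : ∀ x ∈ U,
      (x 0 - x 2) ^ 2 * (pd2 f 0 3 x * pd2 f 1 2 x - pd2 f 0 2 x * pd2 f 1 3 x)
      + pd f 1 x * pd f 3 x = 0) :
    ∀ lam : ℝ, ∀ x ∈ U,
      lieB
        (fun y =>
          ![y 0 - lam,
            pd2 f 0 3 y / pd2 f 1 3 y * (lam - y 0),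
            0,
            (lam - y 2) * pd f 1 y / ((y 0 - y 2) * pd2 f 1 3 y)])
        (fun y =>
          ![0,
            -((lam - y 0) * pd f 3 y / ((y 0 - y 2) * pd2 f 1 3 y)),
            y 2 - lam,
            pd2 f 1 2 y / pd2 f 1 3 y * (lam - y 2)])
        x = 0 := by
  intro lam x hx
  have hfd (j : Fin 4) : DifferentiableAt ℝ (pd f j) x :=
    ((contDiffOn_pd (m := 2) hU hf (by norm_num) j).contDiffAt (hU.mem_nhds hx)).differentiableAt
      two_ne_zero
  have hfd2 (i j : Fin 4) : DifferentiableAt ℝ (pd2 f i j) x :=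
    ((contDiffOn_pd (m := 1) hU (contDiffOn_pd (m := 2) hU hf (by norm_num) j)
      (by norm_num) i).contDiffAt (hU.mem_nhds hx)).differentiableAt one_ne_zero
  have hc (i : Fin 4) : DifferentiableAt ℝ (fun y : Fin 4 → ℝ => y i) x :=
    differentiableAt_apply i x
  have hs : x 0 - x 2 ≠ 0 := sub_ne_zero.mpr (hx13 x hx)
  have ha := hf24 x hx
  have hE := heq x hx
  have hdE (k : Fin 4) : pd (fun y => (y 0 - y 2) * (y 0 - y 2) *
      (pd2 f 0 3 y * pd2 f 1 2 y - pd2 f 0 2 y * pd2 f 1 3 y) + pd f 1 y * pd f 3 y) k x = 0 := by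
    rw [pd_congr (g := fun _ => 0), pd_const]
    filter_upwards [hU.mem_nhds hx] with y hy
    linear_combination heq y hy
  have hE1 := hdE 1
  have hE3 := hdE 3
  have hpd (i j : Fin 4) : pd (pd f j) i x = pd2 f i j x := rfl
  have hden : (x 0 - x 2) * pd2 f 1 3 x ≠ 0 := mul_ne_zero hs ha
  have c21 : pd2 f 2 1 x = pd2 f 1 2 x := pd2_comm hU (hf.of_le (by norm_num)) hx _ _
  have c31 : pd2 f 3 1 x = pd2 f 1 3 x := pd2_comm hU (hf.of_le (by norm_num)) hx _ _
  have so := pd_pd2_swap_outer hU hf hx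
  have si := pd_pd2_swap_inner hU hf hx
  have d031 : pd (pd2 f 0 3) 1 x = pd (pd2 f 1 3) 0 x := so 0 3 1
  have d021 : pd (pd2 f 0 2) 1 x = pd (pd2 f 1 2) 0 x := so 0 2 1
  have d123 : pd (pd2 f 1 2) 3 x = pd (pd2 f 1 3) 2 x := by rw [si 1 2 3, so 2 1 3, si 3 1 2]
  have d023 : pd (pd2 f 0 2) 3 x = pd (pd2 f 0 3) 2 x := by rw [si 0 2 3, so 2 0 3, si 3 0 2]
  simp (disch := first | assumption | fun_prop (disch := assumption)) only
    [pd_add, pd_sub, pd_mul, pd_coord, hpd, c31, d031, d021, d123, d023] at hE1 hE3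
  simp only [Fin.reduceEq, if_false] at hE1 hE3
  ext i
  fin_cases i
  · simp [lieB, pd_const, pd_sub, pd_coord, hc]
  · simp (disch := first | assumption | fun_prop (disch := assumption)) [lieB, Fin.sum_univ_four,
      pd_const, pd_sub, pd_mul, pd_neg, pd_div, pd_coord, hpd, d031, -mul_eq_zero]
    linear_combination (norm := (field_simp; ring))
      (x 0 - lam) * (lam - x 2) / (pd2 f 1 3 x ^ 2 * (x 0 - x 2) ^ 2) * hE3 -
      (x 0 - lam) * (lam - x 2) * pd (pd2 f 1 3) 3 x / (pd2 f 1 3 x ^ 3 * (x 0 - x 2) ^ 2) * hE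
  · simp [lieB, pd_const, pd_sub, pd_coord, hc]
  · simp (disch := first | assumption | fun_prop (disch := assumption)) [lieB, Fin.sum_univ_four,
      pd_const, pd_sub, pd_mul, pd_div, pd_coord, hpd, c21, c31, d123, -mul_eq_zero]
    linear_combination (norm := (field_simp; ring))
      -((x 0 - lam) * (lam - x 2)) / (pd2 f 1 3 x ^ 2 * (x 0 - x 2) ^ 2) * hE1 +
      (x 0 - lam) * (lam - x 2) * pd (pd2 f 1 3) 1 x / (pd2 f 1 3 x ^ 3 * (x 0 - x 2) ^ 2) * hE
end
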